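/- For every finite Markov decision process with state space 𝒮 of size S, every subset 𝒪 ⊆ 𝒮×𝒜, every initial distribution μ₁ over 𝒮, and every integer d̃ ≥ 1, the maximum over all (possibly non-stationary) deterministic policies π of the probability of reaching 𝒪 within (S+2)·d̃ steps is at most S² times the maximum over all policies of the probability of reaching 𝒪 within (S+1)·d̃ steps; that is, max_π X^π_{(S+2)d̃}(𝒪, P, μ₁) ≤ S² · max_π X^π_{(S+1)d̃}(𝒪, P, μ₁). -/

import Mathlib

open scoped Classical BigOperators

/-- `reachProb P O d π s` is the probability of reaching the set `O` of state-action pairs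
within `d` steps, following the (possibly non-stationary) deterministic policy `π` under the
transition kernel `P`, starting from state `s`. -/
noncomputable def reachProb {S A : Type*} [Fintype S] (P : S → A → S → ℝ)
    (O : Set (S × A)) : ℕ → (ℕ → S → A) → S → ℝ
  | 0, _, _ => 0
  | d + 1, π, s =>
      if (s, π 0 s) ∈ O then 1
      else ∑ s' : S, P s (π 0 s) s' * reachProb P O d (fun h => π (h + 1)) s'

/-- Reaching probability `X_d^π(O, P, μ)` from an initial distribution `μ`. -/
noncomputable def reach {S A : Type*} [Fintype S] (P : S → A → S → ℝ)
    (O : Set (S × A)) (d : ℕ) (π : ℕ → S → A) (μ : S → ℝ) : ℝ :=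
  ∑ s : S, μ s * reachProb P O d π s

section HorizonShortening

variable {S A : Type*} [Fintype S]

/-- Optimal probability of reaching `O` within `n` steps, by the Bellman recursion. -/
noncomputable def optValue (P : S → A → S → ℝ) (O : Set (S × A)) : ℕ → S → ℝ
  | 0, _ => 0
  | n + 1, s => ⨆ a : A, if (s, a) ∈ O then 1 else ∑ s' : S, P s a s' * optValue P O n s'

/-- Probability of being at `t` at a time when the number of remaining steps is a positive
multiple of `d`, and of then reaching `O` (for the first time) within the remaining steps. -/
noncomputable def visitReachProb (P : S → A → S → ℝ) (O : Set (S × A)) (d : ℕ) (t : S) :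
    ℕ → (ℕ → S → A) → S → ℝ
  | 0, _, _ => 0
  | n + 1, π, s =>
      if d ∣ n + 1 ∧ s = t then reachProb P O (n + 1) π s
      else if (s, π 0 s) ∈ O then 0
      else ∑ s' : S, P s (π 0 s) s' * visitReachProb P O d t n (fun h => π (h + 1)) s'

/-- Probability of being at `t` at two distinct times when the number of remaining steps is a
positive multiple of `d`, and of then reaching `O` (for the first time) within the remaining
steps. -/
noncomputable def twiceVisitReachProb (P : S → A → S → ℝ) (O : Set (S × A)) (d : ℕ) (t : S) :
    ℕ → (ℕ → S → A) → S → ℝ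
  | 0, _, _ => 0
  | n + 1, π, s =>
      if (s, π 0 s) ∈ O then 0
      else if d ∣ n + 1 ∧ s = t then
        ∑ s' : S, P s (π 0 s) s' * visitReachProb P O d t n (fun h => π (h + 1)) s'
      else ∑ s' : S, P s (π 0 s) s' * twiceVisitReachProb P O d t n (fun h => π (h + 1)) s'

variable {P : S → A → S → ℝ} {O : Set (S × A)}

theorem sum_mul_le_of_forall_le {p f : S → ℝ} {c : ℝ} (hp0 : ∀ s, 0 ≤ p s)
    (hp1 : ∑ s : S, p s = 1) (h : ∀ s, f s ≤ c) : ∑ s : S, p s * f s ≤ c :=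
  calc ∑ s : S, p s * f s ≤ ∑ s : S, p s * c :=
        Finset.sum_le_sum fun s _ => mul_le_mul_of_nonneg_left (h s) (hp0 s)
    _ = c := by rw [← Finset.sum_mul, hp1, one_mul]

theorem sum_mul_le_sum_mul {p f g : S → ℝ} (hp0 : ∀ s, 0 ≤ p s) (h : ∀ s, f s ≤ g s) :
    ∑ s : S, p s * f s ≤ ∑ s : S, p s * g s :=
  Finset.sum_le_sum fun s _ => mul_le_mul_of_nonneg_left (h s) (hp0 s)

theorem reachProb_nonneg (hP0 : ∀ s a s', 0 ≤ P s a s') (n : ℕ) (π : ℕ → S → A) (s : S) :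
    0 ≤ reachProb P O n π s := by
  induction n generalizing π s with
  | zero => simp [reachProb]
  | succ n ih =>
    rw [reachProb]
    split_ifs
    · exact zero_le_one
    · exact Finset.sum_nonneg fun s' _ => mul_nonneg (hP0 _ _ _) (ih _ _)

theorem visitReachProb_nonneg (hP0 : ∀ s a s', 0 ≤ P s a s') (d : ℕ) (t : S) (n : ℕ)
    (π : ℕ → S → A) (s : S) : 0 ≤ visitReachProb P O d t n π s := by
  induction n generalizing π s with
  | zero => simp [visitReachProb]
  | succ n ih =>
    rw [visitReachProb]
    split_ifs
    · exact reachProb_nonneg hP0 _ _ _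
    · exact le_rfl
    · exact Finset.sum_nonneg fun s' _ => mul_nonneg (hP0 _ _ _) (ih _ _)

theorem twiceVisitReachProb_nonneg (hP0 : ∀ s a s', 0 ≤ P s a s') (d : ℕ) (t : S) (n : ℕ)
    (π : ℕ → S → A) (s : S) : 0 ≤ twiceVisitReachProb P O d t n π s := by
  induction n generalizing π s with
  | zero => simp [twiceVisitReachProb]
  | succ n ih =>
    rw [twiceVisitReachProb]
    split_ifs
    · exact le_rfl
    · exact Finset.sum_nonneg fun s' _ =>
        mul_nonneg (hP0 _ _ _) (visitReachProb_nonneg hP0 _ _ _ _ _)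
    · exact Finset.sum_nonneg fun s' _ => mul_nonneg (hP0 _ _ _) (ih _ _)

/-- Once `(S + 2 - |U|) d` steps remain, where `U` holds the states already visited at the
checkpoints, reaching `O` takes `d` steps less than allowed, or passes twice through the same
state at checkpoints. -/
theorem reachProb_le_add_sum (hP0 : ∀ s a s', 0 ≤ P s a s') {d : ℕ} (hd : 1 ≤ d) (n : ℕ)
    (π : ℕ → S → A) (s : S) (U : Finset S)
    (hn : (Fintype.card S + 2) * d ≤ n + U.card * d) :
    reachProb P O n π s ≤ reachProb P O (n - d) π s +
      ∑ t : S, if t ∈ U then visitReachProb P O d t n π s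
        else twiceVisitReachProb P O d t n π s := by
  have hnn : ∀ (n : ℕ) (U : Finset S) (π : ℕ → S → A) (s t : S),
      0 ≤ if t ∈ U then visitReachProb P O d t n π s
        else twiceVisitReachProb P O d t n π s := by
    intro n U π s t
    split_ifs
    · exact visitReachProb_nonneg hP0 _ _ _ _ _
    · exact twiceVisitReachProb_nonneg hP0 _ _ _ _ _
  induction n generalizing π s U with
  | zero =>
    have := Nat.mul_le_mul_right d (Finset.card_le_univ U)
    nlinarith
  | succ n ih =>
    have hcard := Nat.mul_le_mul_right d (Finset.card_le_univ U)
    have hdn : 2 * d ≤ n + 1 := by nlinarith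
    have hsub : n + 1 - d = (n - d) + 1 := by omega
    by_cases hgrid : d ∣ n + 1 ∧ s ∈ U
    · have hle := Finset.single_le_sum (fun t _ => hnn (n + 1) U π s t) (Finset.mem_univ s)
      simp only [hgrid.2, if_true] at hle
      have hv : visitReachProb P O d s (n + 1) π s = reachProb P O (n + 1) π s := by
        rw [visitReachProb, if_pos ⟨hgrid.1, rfl⟩]
      have := reachProb_nonneg (O := O) hP0 (n + 1 - d) π s
      linarith
    by_cases hO : (s, π 0 s) ∈ O
    · have h1 : reachProb P O (n + 1) π s = 1 := by rw [reachProb, if_pos hO]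
      have h2 : reachProb P O (n + 1 - d) π s = 1 := by rw [hsub, reachProb, if_pos hO]
      have := Finset.sum_nonneg fun t (_ : t ∈ Finset.univ) => hnn (n + 1) U π s t
      linarith
    have key : ∃ U' : Finset S, (Fintype.card S + 2) * d ≤ n + U'.card * d ∧
        ∀ t, (if t ∈ U then visitReachProb P O d t (n + 1) π s
          else twiceVisitReachProb P O d t (n + 1) π s) =
          ∑ s' : S, P s (π 0 s) s' *
            if t ∈ U' then visitReachProb P O d t n (fun h => π (h + 1)) s'
            else twiceVisitReachProb P O d t n (fun h => π (h + 1)) s' := by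
      by_cases hdvd : d ∣ n + 1
      · have hs : s ∉ U := fun h => hgrid ⟨hdvd, h⟩
        refine ⟨insert s U, ?_, fun t => ?_⟩
        · rw [Finset.card_insert_of_notMem hs]
          nlinarith
        · rw [visitReachProb, twiceVisitReachProb, if_neg hO, if_neg hO]
          by_cases hst : s = t
          · subst hst
            simp [hs, hdvd]
          · have hts : t ≠ s := Ne.symm hst
            by_cases htU : t ∈ U <;> simp [hst, hts, htU]
      · refine ⟨U, ?_, fun t => ?_⟩
        · rcases Nat.lt_or_ge (n + U.card * d) ((Fintype.card S + 2) * d) with hlt | hge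
          · exfalso
            apply hdvd
            have heq : n + 1 + U.card * d = (Fintype.card S + 2) * d := by omega
            exact (Nat.dvd_add_left (Dvd.intro_left U.card rfl)).1
              (heq ▸ Dvd.intro_left (Fintype.card S + 2) rfl)
          · exact hge
        · rw [visitReachProb, twiceVisitReachProb, if_neg hO, if_neg hO]
          by_cases htU : t ∈ U <;> simp [hdvd, htU]
    obtain ⟨U', hU', hsum⟩ := key
    rw [Finset.sum_congr rfl fun t _ => hsum t, Finset.sum_comm, hsub, reachProb, reachProb,
      if_neg hO, if_neg hO, ← Finset.sum_add_distrib]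
    refine Finset.sum_le_sum fun s' _ => ?_
    rw [← Finset.mul_sum, ← mul_add]
    exact mul_le_mul_of_nonneg_left (ih _ _ U' hU') (hP0 _ _ _)

variable [Fintype A]

theorem le_optValue_succ (n : ℕ) (s : S) (a : A) :
    (if (s, a) ∈ O then 1 else ∑ s' : S, P s a s' * optValue P O n s') ≤
      optValue P O (n + 1) s :=
  le_ciSup (f := fun a : A => if (s, a) ∈ O then (1 : ℝ) else
    ∑ s' : S, P s a s' * optValue P O n s') (Set.finite_range _).bddAbove a

theorem reachProb_le_optValue (hP0 : ∀ s a s', 0 ≤ P s a s') (n : ℕ) (π : ℕ → S → A) (s : S) :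
    reachProb P O n π s ≤ optValue P O n s := by
  induction n generalizing π s with
  | zero => simp [reachProb, optValue]
  | succ n ih =>
    refine le_trans ?_ (le_optValue_succ n s (π 0 s))
    rw [reachProb]
    split_ifs
    · exact le_rfl
    · exact sum_mul_le_sum_mul (hP0 _ _) fun s' => ih _ _

variable [Nonempty A]

theorem exists_reachProb_eq_optValue (P : S → A → S → ℝ) (O : Set (S × A)) (n : ℕ) :
    ∃ π : ℕ → S → A, ∀ s, reachProb P O n π s = optValue P O n s := by
  induction n with
  | zero => exact ⟨fun _ _ => Classical.arbitrary A, fun s => by simp [reachProb, optValue]⟩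
  | succ n ih =>
    obtain ⟨π, hπ⟩ := ih
    have hmax : ∀ s : S, ∃ a : A,
        (if (s, a) ∈ O then 1 else ∑ s' : S, P s a s' * optValue P O n s') =
          optValue P O (n + 1) s := fun s =>
      exists_eq_ciSup_of_finite (f := fun a : A => if (s, a) ∈ O then (1 : ℝ) else
        ∑ s' : S, P s a s' * optValue P O n s')
    choose a ha using hmax
    refine ⟨fun h => Nat.casesOn h a π, fun s => ?_⟩
    rw [← ha s, reachProb]
    simp [hπ]

theorem optValue_nonneg (hP0 : ∀ s a s', 0 ≤ P s a s') (n : ℕ) (s : S) :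
    0 ≤ optValue P O n s :=
  (reachProb_nonneg hP0 n (fun _ _ => Classical.arbitrary A) s).trans
    (reachProb_le_optValue hP0 _ _ _)

theorem optValue_mono (hP0 : ∀ s a s', 0 ≤ P s a s') (s : S) :
    Monotone fun n => optValue P O n s := by
  refine monotone_nat_of_le_succ fun n => ?_
  induction n generalizing s with
  | zero => exact optValue_nonneg hP0 1 s
  | succ n ih =>
    rw [optValue]
    refine ciSup_le fun a => le_trans ?_ (le_optValue_succ (n + 1) s a)
    split_ifs
    · exact le_rfl
    · exact sum_mul_le_sum_mul (hP0 _ _) ih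

theorem visitReachProb_le_optValue (hP0 : ∀ s a s', 0 ≤ P s a s')
    (hP1 : ∀ s a, ∑ s' : S, P s a s' = 1) (d : ℕ) (t : S) (n : ℕ) (π : ℕ → S → A) (s : S) :
    visitReachProb P O d t n π s ≤ optValue P O (d * (n / d)) t := by
  induction n generalizing π s with
  | zero => exact optValue_nonneg hP0 _ _
  | succ n ih =>
    rw [visitReachProb]
    split_ifs with h
    · obtain ⟨hdvd, rfl⟩ := h
      rw [Nat.mul_div_cancel' hdvd]
      exact reachProb_le_optValue hP0 _ _ _
    · exact optValue_nonneg hP0 _ _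
    · exact (sum_mul_le_of_forall_le (hP0 _ _) (hP1 _ _) fun s' => ih _ s').trans
        (optValue_mono hP0 t (Nat.mul_le_mul_left d (Nat.div_le_div_right (Nat.le_succ n))))

theorem twiceVisitReachProb_le_optValue (hP0 : ∀ s a s', 0 ≤ P s a s')
    (hP1 : ∀ s a, ∑ s' : S, P s a s' = 1) {d : ℕ} (hd : 1 ≤ d) (t : S) (n : ℕ)
    (π : ℕ → S → A) (s : S) :
    twiceVisitReachProb P O d t n π s ≤ optValue P O (n - d) s := by
  induction n generalizing π s with
  | zero => exact optValue_nonneg hP0 _ _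
  | succ n ih =>
    rw [twiceVisitReachProb]
    split_ifs with hO h
    · exact optValue_nonneg hP0 _ _
    · obtain ⟨⟨k, hk⟩, rfl⟩ := h
      refine (sum_mul_le_of_forall_le (hP0 _ _) (hP1 _ _) fun s' =>
        visitReachProb_le_optValue hP0 hP1 d s n _ s').trans (optValue_mono hP0 s ?_)
      have hlt : n / d < k := (Nat.div_lt_iff_lt_mul hd).2 (by rw [mul_comm]; omega)
      have := Nat.mul_le_mul_left d (Nat.succ_le_of_lt hlt)
      rw [Nat.succ_eq_add_one, mul_add, mul_one] at this
      omega
    · refine (sum_mul_le_sum_mul (hP0 _ _) fun s' => ih _ s').trans ?_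
      rcases Nat.lt_or_ge n d with hlt | hge
      · rw [Nat.sub_eq_zero_of_le hlt.le]
        simpa [optValue] using optValue_nonneg hP0 (n + 1 - d) s
      · rw [Nat.sub_add_comm hge]
        simpa [hO] using le_optValue_succ (P := P) (O := O) (n - d) s (π 0 s)

theorem optValue_le_optValue_one [Subsingleton S] (hP0 : ∀ s a s', 0 ≤ P s a s')
    (hP1 : ∀ s a, ∑ s' : S, P s a s' = 1) (n : ℕ) (s : S) :
    optValue P O n s ≤ optValue P O 1 s := by
  induction n with
  | zero => exact optValue_nonneg hP0 1 s
  | succ n ih =>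
    rw [optValue]
    refine ciSup_le fun a => ?_
    split_ifs with hO
    · simpa [hO] using le_optValue_succ (P := P) (O := O) 0 s a
    · exact sum_mul_le_of_forall_le (hP0 _ _) (hP1 _ _) fun s' => Subsingleton.elim s s' ▸ ih

theorem reachProb_le_card_sq_mul_optValue (hP0 : ∀ s a s', 0 ≤ P s a s')
    (hP1 : ∀ s a, ∑ s' : S, P s a s' = 1) {d : ℕ} (hd : 1 ≤ d) (π : ℕ → S → A) (s : S) :
    reachProb P O ((Fintype.card S + 2) * d) π s ≤
      (Fintype.card S : ℝ) ^ 2 * optValue P O ((Fintype.card S + 1) * d) s := by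
  have hpos : 0 < Fintype.card S := Fintype.card_pos_iff.2 ⟨s⟩
  rcases Nat.lt_or_ge (Fintype.card S) 2 with hlt | hge
  · have hone : Fintype.card S = 1 := by omega
    have : Subsingleton S := Fintype.card_le_one_iff_subsingleton.1 hone.le
    rw [hone, Nat.cast_one, one_pow, one_mul]
    exact (reachProb_le_optValue hP0 _ _ _).trans
      ((optValue_le_optValue_one hP0 hP1 _ s).trans (optValue_mono hP0 s (by omega)))
  · have hsub : (Fintype.card S + 2) * d - d = (Fintype.card S + 1) * d := by
      rw [← Nat.sub_one_mul]
      rfl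
    have hmain := reachProb_le_add_sum (O := O) hP0 hd _ π s ∅
      (Nat.le_add_right ((Fintype.card S + 2) * d) _)
    simp only [Finset.notMem_empty, if_false, hsub] at hmain
    have hsum := Finset.sum_le_card_nsmul Finset.univ _ _ fun t (_ : t ∈ Finset.univ) =>
      twiceVisitReachProb_le_optValue (O := O) hP0 hP1 hd t ((Fintype.card S + 2) * d) π s
    rw [hsub, Finset.card_univ, nsmul_eq_mul] at hsum
    have hle := reachProb_le_optValue (O := O) hP0 ((Fintype.card S + 1) * d) π s
    have hnonneg := optValue_nonneg (O := O) hP0 ((Fintype.card S + 1) * d) s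
    have hcard : (2 : ℝ) ≤ Fintype.card S := by exact_mod_cast hge
    have hsq : (1 : ℝ) + Fintype.card S ≤ (Fintype.card S : ℝ) ^ 2 := by nlinarith
    have := mul_le_mul_of_nonneg_right hsq hnonneg
    linarith

end HorizonShortening

/-- For every finite MDP with `S` states, every `O ⊆ 𝒮 × 𝒜`, every initial distribution `μ`
and every `d̃ ≥ 1`, the maximal probability of reaching `O` within `(S+2)d̃` steps is at most
`S²` times the maximal probability of reaching `O` within `(S+1)d̃` steps. -/
theorem max_reach_horizon_shortening {S A : Type*} [Fintype S] [Fintype A] [Nonempty A]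
    (P : S → A → S → ℝ)
    (hP0 : ∀ s a s', 0 ≤ P s a s') (hP1 : ∀ s a, ∑ s' : S, P s a s' = 1)
    (O : Set (S × A)) (μ₁ : S → ℝ) (hμ0 : ∀ s, 0 ≤ μ₁ s) (hμ1 : ∑ s : S, μ₁ s = 1)
    (d : ℕ) (hd : 1 ≤ d) (π : ℕ → S → A) :
    ∃ π' : ℕ → S → A,
      reach P O ((Fintype.card S + 2) * d) π μ₁ ≤
        (Fintype.card S : ℝ) ^ 2 * reach P O ((Fintype.card S + 1) * d) π' μ₁ := by
  obtain ⟨π', hπ'⟩ := exists_reachProb_eq_optValue P O ((Fintype.card S + 1) * d)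
  refine ⟨π', ?_⟩
  rw [reach, reach, Finset.mul_sum]
  refine Finset.sum_le_sum fun s _ => ?_
  rw [hπ' s, mul_left_comm]
  exact mul_le_mul_of_nonneg_left (reachProb_le_card_sq_mul_optValue hP0 hP1 hd π s) (hμ0 s)
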